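/- arXiv:2505.11434 — 3 statements merged into one kernel-verified Lean document; each statement's English description precedes it below -/
import Mathlib

section
/- Let X be a separable real Hilbert space, f : X → ℝ convex, continuously differentiable, L-smooth with nonempty set of minimizers, and x⋆ its minimum-norm minimizer. Let C_α, C_λ > 0, p ∈ (0, 1], q ∈ [0, 1 − p], and assume: C_α < 2/L if q = 0; 2 C_λ C_α > 1 − q if q = 1 − p and q ≠ 0; and 2 C_λ C_α (1 − L C_α/2) > 1 if q = 0 and p = 1. Let (x_k) be generated by the deterministic regularized gradient descent x_k = x_{k-1} − α_k(∇f(x_{k-1}) + λ_k x_{k-1}) with α_k = C_α k^{−q} and λ_k = C_λ k^{−p}. Then the energy satisfies E_k ∈ O(k^{−1+q}), where E_k = f_{λ_{k+1}}(x_k) − f_{λ_{k+1}}(x_{λ_{k+1}}). -/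
open MeasureTheory Filter Asymptotics Real

theorem hasDerivAt_comp_add_smul {H : Type*} [NormedAddCommGroup H] [InnerProductSpace ℝ H]
    [CompleteSpace H] {f : H → ℝ} (hf : Differentiable ℝ f) (x d : H) (t : ℝ) :
    HasDerivAt (fun s : ℝ => f (x + s • d)) (inner ℝ (gradient f (x + t • d)) d) t := by
  have hline : HasDerivAt (fun s : ℝ => x + s • d) d t := by
    simpa using ((hasDerivAt_id t).smul_const d).const_add x
  have h := (hf (x + t • d)).hasGradientAt.hasFDerivAt.comp_hasDerivAt t hline
  simpa [Function.comp_def] using h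

theorem ConvexOn.add_inner_gradient_le {H : Type*} [NormedAddCommGroup H]
    [InnerProductSpace ℝ H] [CompleteSpace H] {f : H → ℝ} (hconv : ConvexOn ℝ Set.univ f)
    (hf : Differentiable ℝ f) (x y : H) :
    f x + inner ℝ (gradient f x) (y - x) ≤ f y := by
  have hline : ConvexOn ℝ Set.univ (fun s : ℝ => f (x + s • (y - x))) := by
    have h := hconv.comp_affineMap (AffineMap.lineMap x y : ℝ →ᵃ[ℝ] H)
    simpa [Function.comp_def, AffineMap.lineMap_apply, add_comm] using h
  have h := hline.le_slope_of_hasDerivAt (Set.mem_univ 0) (Set.mem_univ 1) one_pos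
    (hasDerivAt_comp_add_smul hf x (y - x) 0)
  simp [slope_def_field] at h ⊢
  linarith

/-- The descent lemma for functions with Lipschitz gradient. -/
theorem le_add_inner_gradient_add_of_lipschitzWith {H : Type*} [NormedAddCommGroup H]
    [InnerProductSpace ℝ H] [CompleteSpace H] {f : H → ℝ} {L : ℝ} (hL : 0 ≤ L)
    (hf : Differentiable ℝ f) (hLip : LipschitzWith L.toNNReal (gradient f)) (x d : H) :
    f (x + d) ≤ f x + inner ℝ (gradient f x) d + L / 2 * ‖d‖ ^ 2 := by
  have hder (t : ℝ) : HasDerivAt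
      (fun s : ℝ => f (x + s • d) - s * inner ℝ (gradient f x) d - L / 2 * ‖d‖ ^ 2 * s ^ 2)
      (inner ℝ (gradient f (x + t • d)) d - inner ℝ (gradient f x) d
        - L / 2 * ‖d‖ ^ 2 * (2 * t)) t := by
    have h1 := (hasDerivAt_id t).mul_const (inner ℝ (gradient f x) d)
    have h2 := (hasDerivAt_pow 2 t).const_mul (L / 2 * ‖d‖ ^ 2)
    rw [one_mul] at h1
    norm_num at h2
    exact ((hasDerivAt_comp_add_smul hf x d t).sub h1).sub h2
  have hanti := antitoneOn_of_deriv_nonpos (convex_Icc (0 : ℝ) 1)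
    (fun t _ => (hder t).continuousAt.continuousWithinAt)
    (fun t _ => (hder t).differentiableAt.differentiableWithinAt) (by
      intro t ht
      rw [interior_Icc] at ht
      rw [(hder t).deriv, ← inner_sub_left]
      have h1 := real_inner_le_norm (gradient f (x + t • d) - gradient f x) d
      have h2 := hLip.dist_le_mul (x + t • d) x
      rw [dist_eq_norm, dist_eq_norm, add_sub_cancel_left, norm_smul, Real.norm_eq_abs,
        abs_of_pos ht.1, Real.coe_toNNReal L hL] at h2
      nlinarith [mul_le_mul_of_nonneg_right h2 (norm_nonneg d)])
  have h := hanti (Set.left_mem_Icc.2 zero_le_one) (Set.right_mem_Icc.2 zero_le_one) zero_le_one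
  simp at h ⊢
  linarith

/-- One gradient step with step size `a` on `f + l / 2 * ‖·‖ ^ 2`, measured against any `z`. -/
theorem regularized_gradient_step_le {H : Type*} [NormedAddCommGroup H]
    [InnerProductSpace ℝ H] [CompleteSpace H] {f : H → ℝ} {L l a : ℝ} (hL : 0 ≤ L)
    (hconv : ConvexOn ℝ Set.univ f) (hf : Differentiable ℝ f)
    (hLip : LipschitzWith L.toNNReal (gradient f)) (hl : 0 ≤ l) (ha : 0 ≤ a)
    (hal : 0 ≤ 1 - (L + l) * a / 2) (x z : H) :
    f (x - a • (gradient f x + l • x)) + l / 2 * ‖x - a • (gradient f x + l • x)‖ ^ 2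
        - (f z + l / 2 * ‖z‖ ^ 2)
      ≤ (1 - 2 * l * a * (1 - (L + l) * a / 2))
        * (f x + l / 2 * ‖x‖ ^ 2 - (f z + l / 2 * ‖z‖ ^ 2)) := by
  have hdesc := le_add_inner_gradient_add_of_lipschitzWith hL hf hLip x
    (-(a • (gradient f x + l • x)))
  have hlow := hconv.add_inner_gradient_le hf x z
  have hz : 0 ≤ ‖(gradient f x + l • x) + l • (z - x)‖ ^ 2 := sq_nonneg _
  set g := gradient f x
  have hnz : ‖z‖ ^ 2 = ‖x‖ ^ 2 + 2 * inner ℝ x (z - x) + ‖z - x‖ ^ 2 := by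
    rw [← norm_add_sq_real, add_sub_cancel]
  have hnd : ‖x - a • (g + l • x)‖ ^ 2
      = ‖x‖ ^ 2 - 2 * (a * inner ℝ x (g + l • x)) + a ^ 2 * ‖g + l • x‖ ^ 2 := by
    rw [norm_sub_sq_real, inner_smul_right, norm_smul, mul_pow, Real.norm_eq_abs, sq_abs]
  have hG : ‖g + l • x‖ ^ 2 = inner ℝ g (g + l • x) + l * inner ℝ x (g + l • x) := by
    rw [← real_inner_self_eq_norm_sq, inner_add_left, inner_smul_left]; simp
  rw [norm_neg, inner_neg_right, inner_smul_right, norm_smul, mul_pow, Real.norm_eq_abs, sq_abs,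
    ← sub_eq_add_neg] at hdesc
  rw [norm_add_sq_real, inner_smul_right, inner_add_left, inner_smul_left, norm_smul, mul_pow,
    Real.norm_eq_abs, sq_abs] at hz
  simp only [conj_trivial] at hz
  have hpl : 2 * l * (f x + l / 2 * ‖x‖ ^ 2 - (f z + l / 2 * ‖z‖ ^ 2)) ≤ ‖g + l • x‖ ^ 2 := by
    rw [hnz]
    nlinarith [mul_le_mul_of_nonneg_left hlow hl]
  have hstep : f (x - a • (g + l • x)) + l / 2 * ‖x - a • (g + l • x)‖ ^ 2
      ≤ f x + l / 2 * ‖x‖ ^ 2 - a * (1 - (L + l) * a / 2) * ‖g + l • x‖ ^ 2 := by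
    rw [hnd]
    have : a * (1 - (L + l) * a / 2) * ‖g + l • x‖ ^ 2
      = a * (inner ℝ g (g + l • x) + l * inner ℝ x (g + l • x))
        - (L + l) / 2 * (a ^ 2 * ‖g + l • x‖ ^ 2) := by rw [← hG]; ring
    linarith
  have := mul_le_mul_of_nonneg_left hpl (mul_nonneg ha hal)
  linarith

theorem norm_le_of_isMinOn_regularized {H : Type*} [NormedAddCommGroup H] {f : H → ℝ} {l : ℝ}
    (hl : 0 < l) {x y : H} (hx : IsMinOn f Set.univ x)
    (hy : IsMinOn (fun z => f z + l / 2 * ‖z‖ ^ 2) Set.univ y) : ‖y‖ ≤ ‖x‖ := by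
  have h1 : f x ≤ f y := hx (Set.mem_univ y)
  have h2 : f y + l / 2 * ‖y‖ ^ 2 ≤ f x + l / 2 * ‖x‖ ^ 2 := hy (Set.mem_univ x)
  have h3 : l / 2 * ‖y‖ ^ 2 ≤ l / 2 * ‖x‖ ^ 2 := by linarith
  exact (sq_le_sq₀ (norm_nonneg y) (norm_nonneg x)).1 (le_of_mul_le_mul_left h3 (by positivity))

theorem rpow_neg_mul_one_sub_div_le {r t : ℝ} (hr0 : 0 ≤ r) (hr1 : r ≤ 1) (ht : 0 < t) :
    t ^ (-r) * (1 - r / t) ≤ (t + 1) ^ (-r) := by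
  have hB : (1 + t⁻¹) ^ r ≤ 1 + r * t⁻¹ :=
    rpow_one_add_le_one_add_mul_self (by linarith [inv_pos.2 ht]) hr0 hr1
  have hpos : 0 < (1 + t⁻¹) ^ r := by positivity
  have hprod : (t + 1) ^ (-r) = t ^ (-r) * (1 + t⁻¹) ^ (-r) := by
    rw [← Real.mul_rpow ht.le (by positivity)]
    congr 1
    field_simp
  rw [hprod, Real.rpow_neg (show 0 ≤ 1 + t⁻¹ by positivity)]
  refine mul_le_mul_of_nonneg_left ?_ (by positivity)
  rw [← one_div, le_div_iff₀ hpos, div_eq_mul_inv]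
  have hrt : 0 ≤ r * t⁻¹ := by positivity
  rcases le_total (1 - r * t⁻¹) 0 with h | h
  · nlinarith
  · nlinarith [mul_le_mul_of_nonneg_left hB h]

/-- A Chung-type lemma: the recursion contracts at rate `a k * (k + 1) ^ (-s)` with a
perturbation of order `(k + 1) ^ (-(r + s))`. -/
theorem eventually_le_rpow_of_recursion {e a : ℕ → ℝ} {r s B δ : ℝ} (hB : 0 ≤ B) (hr0 : 0 ≤ r) (hr1 : r ≤ 1)
    (hδ : 0 < δ)
    (hrec : ∀ᶠ k : ℕ in atTop, e (k + 1)
      ≤ (1 - a k * ((k : ℝ) + 1) ^ (-s)) * e k + B * ((k : ℝ) + 1) ^ (-(r + s)))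
    (hcontr : ∀ᶠ k : ℕ in atTop, 0 ≤ 1 - a k * ((k : ℝ) + 1) ^ (-s))
    (hgap : ∀ᶠ k : ℕ in atTop, δ ≤ a k - r * ((k : ℝ) + 1) ^ (s - 1)) :
    ∃ M : ℝ, ∀ᶠ k : ℕ in atTop, e k ≤ M * ((k : ℝ) + 1) ^ (-r) := by
  obtain ⟨N, hN⟩ := eventually_atTop.1 (hrec.and (hcontr.and hgap))
  refine ⟨max (B / δ) (e N * ((N : ℝ) + 1) ^ r), eventually_atTop.2 ⟨N, fun k hk => ?_⟩⟩
  set M := max (B / δ) (e N * ((N : ℝ) + 1) ^ r)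
  induction k, hk using Nat.le_induction with
  | base =>
    have hpos : (0 : ℝ) < ((N : ℝ) + 1) ^ (-r) := by positivity
    calc e N = e N * ((N : ℝ) + 1) ^ r * ((N : ℝ) + 1) ^ (-r) := by
          rw [mul_assoc, ← Real.rpow_add (by positivity)]; simp
      _ ≤ M * ((N : ℝ) + 1) ^ (-r) := by gcongr; exact le_max_right _ _
  | succ k hk ih =>
    obtain ⟨h1, h2, h3⟩ := hN k hk
    push_cast
    set t : ℝ := (k : ℝ) + 1
    have ht : 0 < t := by positivity
    have hMB : B ≤ M * δ := (div_le_iff₀ hδ).1 (le_max_left _ _)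
    have hM : 0 ≤ M := (div_nonneg hB hδ.le).trans (le_max_left _ _)
    have hrs : t ^ (-(r + s)) = t ^ (-r) * t ^ (-s) := by rw [← Real.rpow_add ht]; ring_nf
    have hs : t ^ (s - 1) * t ^ (-s) = 1 / t := by
      rw [← Real.rpow_add ht, one_div, ← Real.rpow_neg_one]; ring_nf
    have hdec := rpow_neg_mul_one_sub_div_le hr0 hr1 ht
    calc e (k + 1) ≤ (1 - a k * t ^ (-s)) * (M * t ^ (-r)) + M * δ * t ^ (-(r + s)) :=
          h1.trans (add_le_add (mul_le_mul_of_nonneg_left ih h2) (by gcongr))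
      _ ≤ (1 - a k * t ^ (-s)) * (M * t ^ (-r))
          + M * (a k - r * t ^ (s - 1)) * t ^ (-(r + s)) := by gcongr
      _ = M * (t ^ (-r) * (1 - r * (t ^ (s - 1) * t ^ (-s)))) := by rw [hrs]; ring
      _ = M * (t ^ (-r) * (1 - r / t)) := by rw [hs]; ring
      _ ≤ M * (t + 1) ^ (-r) := by gcongr

theorem regGD_energy_rate
    {H : Type*} [NormedAddCommGroup H] [InnerProductSpace ℝ H] [CompleteSpace H]
    [TopologicalSpace.SeparableSpace H]
    (f : H → ℝ) (L : ℝ) (hL : 0 < L)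
    (hconv : ConvexOn ℝ Set.univ f)
    (hC1 : ContDiff ℝ 1 f)
    (hLip : LipschitzWith L.toNNReal (gradient f))
    (xstar : H) (hxmin : IsMinOn f Set.univ xstar)
    (hminnorm : ∀ y : H, IsMinOn f Set.univ y → ‖xstar‖ ≤ ‖y‖)
    (xlam : ℝ → H)
    (hxlam : ∀ l : ℝ, 0 < l → IsMinOn (fun x => f x + l / 2 * ‖x‖ ^ 2) Set.univ (xlam l))
    (Cα Clam p q : ℝ) (hCα : 0 < Cα) (hClam : 0 < Clam)
    (hp : 0 < p ∧ p ≤ 1) (hq : 0 ≤ q ∧ q ≤ 1 - p)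
    (hcond1 : q = 0 → Cα < 2 / L)
    (hcond2 : q = 1 - p ∧ q ≠ 0 → 2 * Clam * Cα > 1 - q)
    (hcond3 : q = 0 ∧ p = 1 → 2 * Clam * Cα * (1 - L * Cα / 2) > 1)
    (α lam : ℕ → ℝ)
    (hαdef : ∀ k : ℕ, α k = Cα * (k : ℝ) ^ (-q))
    (hlamdef : ∀ k : ℕ, lam k = Clam * (k : ℝ) ^ (-p))
    (x : ℕ → H)
    (hrec : ∀ k : ℕ, x (k + 1) = x k - α (k + 1) • (gradient f (x k) + lam (k + 1) • x k))
    (E : ℕ → ℝ)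
    (hE : ∀ k : ℕ, E k
      = (f (x k) + lam (k + 1) / 2 * ‖x k‖ ^ 2)
        - (f (xlam (lam (k + 1))) + lam (k + 1) / 2 * ‖xlam (lam (k + 1))‖ ^ 2)) :
    (fun k : ℕ => E k) =O[atTop] fun k : ℕ => (k : ℝ) ^ (q - 1) := by
  have hf : Differentiable ℝ f := hC1.differentiable (by norm_num)
  obtain ⟨hp0, hp1⟩ := hp
  obtain ⟨hq0, hq1⟩ := hq
  have hlam (k : ℕ) : lam (k + 1) = Clam * ((k : ℝ) + 1) ^ (-p) := by simp [hlamdef]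
  have hα (k : ℕ) : α (k + 1) = Cα * ((k : ℝ) + 1) ^ (-q) := by simp [hαdef]
  have hlampos (k : ℕ) : 0 < lam (k + 1) := by rw [hlam]; positivity
  have hαpos (k : ℕ) : 0 < α (k + 1) := by rw [hα]; positivity
  have hlamα (k : ℕ) : lam (k + 1) * α (k + 1) = Clam * Cα * ((k : ℝ) + 1) ^ (-(p + q)) := by
    rw [hlam, hα, neg_add, Real.rpow_add (by positivity)]; ring
  have hatTop : Tendsto (fun k : ℕ => (k : ℝ) + 1) atTop atTop :=
    tendsto_atTop_add_const_right _ _ tendsto_natCast_atTop_atTop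
  have hneg {u : ℝ} (hu : 0 < u) :
      Tendsto (fun k : ℕ => ((k : ℝ) + 1) ^ (-u)) atTop (nhds 0) :=
    (tendsto_rpow_neg_atTop hu).comp hatTop
  have hlam0 : Tendsto (fun k => lam (k + 1)) atTop (nhds 0) := by
    simp_rw [hlam]; simpa using (hneg hp0).const_mul Clam
  have hαlim : Tendsto (fun k => α (k + 1)) atTop (nhds (if q = 0 then Cα else 0)) := by
    simp_rw [hα]
    split_ifs with h
    · simp [h]
    · simpa using (hneg (lt_of_le_of_ne hq0 (Ne.symm h))).const_mul Cα
  set κ : ℕ → ℝ := fun k => 1 - (L + lam (k + 1)) * α (k + 1) / 2 with hκ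
  have hκlim : Tendsto κ atTop (nhds (1 - L * (if q = 0 then Cα else 0) / 2)) := by
    simpa using (((hlam0.const_add L).mul hαlim).div_const 2).const_sub 1
  have hκ1 (k : ℕ) : κ k ≤ 1 := by
    have := mul_pos (add_pos hL (hlampos k)) (hαpos k)
    simp only [hκ]; linarith
  have hslim : Tendsto (fun k : ℕ => ((k : ℝ) + 1) ^ (p + q - 1)) atTop
      (nhds (if p + q = 1 then 1 else 0)) := by
    split_ifs with h
    · simp [h]
    · have hlt : 0 < 1 - (p + q) := sub_pos.2 (lt_of_le_of_ne (by linarith) h)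
      simpa using hneg hlt
  have hκ0 : 0 < 1 - L * (if q = 0 then Cα else 0) / 2 := by
    split_ifs with h
    · have := (lt_div_iff₀ hL).1 (hcond1 h)
      linarith
    · simp
  have hlimpos : 0 < 2 * Clam * Cα * (1 - L * (if q = 0 then Cα else 0) / 2)
      - (1 - q) * (if p + q = 1 then 1 else 0) := by
    by_cases h1 : p + q = 1
    · by_cases h2 : q = 0
      · have := hcond3 ⟨h2, by linarith⟩
        rw [if_pos h1, if_pos h2, h2]; linarith
      · have := hcond2 ⟨by linarith, h2⟩
        rw [if_pos h1, if_neg h2]; linarith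
    · simp only [h1, if_false, mul_zero, sub_zero]
      positivity
  obtain ⟨δ, hδ, hδlt⟩ := exists_between hlimpos
  have hgap : ∀ᶠ k : ℕ in atTop,
      δ ≤ 2 * Clam * Cα * κ k - (1 - q) * ((k : ℝ) + 1) ^ (p + q - 1) :=
    ((hκlim.const_mul _).sub (hslim.const_mul _)).eventually_const_le hδlt
  have hcontr : ∀ᶠ k : ℕ in atTop,
      0 ≤ 1 - 2 * Clam * Cα * κ k * ((k : ℝ) + 1) ^ (-(p + q)) := by
    have h := (hneg (show 0 < p + q by linarith)).const_mul (2 * Clam * Cα)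
    rw [mul_zero] at h
    filter_upwards [h.eventually_le_const one_pos] with k hk
    have : 2 * Clam * Cα * κ k * ((k : ℝ) + 1) ^ (-(p + q))
        ≤ 2 * Clam * Cα * 1 * ((k : ℝ) + 1) ^ (-(p + q)) := by gcongr; exact hκ1 k
    linarith
  have hErec : ∀ᶠ k : ℕ in atTop, E (k + 1)
      ≤ (1 - 2 * Clam * Cα * κ k * ((k : ℝ) + 1) ^ (-(p + q))) * E k
        + Clam * p / 2 * ‖xstar‖ ^ 2 * ((k : ℝ) + 1) ^ (-((1 - q) + (p + q))) := by
    filter_upwards [hκlim.eventually_const_le hκ0] with k hk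
    have hstep := regularized_gradient_step_le hL.le hconv hf hLip (hlampos k).le (hαpos k).le hk
      (x k) (xlam (lam (k + 1)))
    rw [← hrec, ← hE, mul_assoc 2, hlamα k] at hstep
    have hmin : f (xlam (lam (k + 1))) + lam (k + 1) / 2 * ‖xlam (lam (k + 1))‖ ^ 2
        ≤ f (xlam (lam (k + 2))) + lam (k + 1) / 2 * ‖xlam (lam (k + 2))‖ ^ 2 :=
      hxlam _ (hlampos k) (Set.mem_univ _)
    have hnorm := norm_le_of_isMinOn_regularized (hlampos (k + 1)) hxmin (hxlam _ (hlampos (k + 1)))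
    have hnormsq : ‖xlam (lam (k + 2))‖ ^ 2 ≤ ‖xstar‖ ^ 2 := by gcongr
    have ht : (0 : ℝ) < (k : ℝ) + 1 := by positivity
    have hle : lam (k + 2) ≤ lam (k + 1) := by
      rw [hlam k, hlam (k + 1)]
      push_cast
      exact mul_le_mul_of_nonneg_left
        (Real.rpow_le_rpow_of_nonpos ht (by linarith) (by linarith)) hClam.le
    have hdiff : lam (k + 1) - lam (k + 2)
        ≤ Clam * p * ((k : ℝ) + 1) ^ (-((1 - q) + (p + q))) := by
      have h := rpow_neg_mul_one_sub_div_le hp0.le hp1 ht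
      have hexp : ((k : ℝ) + 1) ^ (-((1 - q) + (p + q)))
          = ((k : ℝ) + 1) ^ (-p) / ((k : ℝ) + 1) := by
        rw [← Real.rpow_sub_one ht.ne']; ring_nf
      rw [hlam k, hlam (k + 1), hexp]
      push_cast
      have h' := mul_le_mul_of_nonneg_left h hClam.le
      calc _ ≤ Clam * ((k : ℝ) + 1) ^ (-p)
            - Clam * (((k : ℝ) + 1) ^ (-p) * (1 - p / ((k : ℝ) + 1))) := by linarith
        _ = _ := by ring
    have hpert : (lam (k + 1) - lam (k + 2)) / 2 * (‖xlam (lam (k + 2))‖ ^ 2 - ‖x (k + 1)‖ ^ 2)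
        ≤ Clam * p * ((k : ℝ) + 1) ^ (-((1 - q) + (p + q))) / 2 * ‖xstar‖ ^ 2 := by
      calc _ ≤ (lam (k + 1) - lam (k + 2)) / 2 * ‖xstar‖ ^ 2 :=
            mul_le_mul_of_nonneg_left (by nlinarith [sq_nonneg ‖x (k + 1)‖]) (by linarith)
        _ ≤ _ := by gcongr
    rw [hE (k + 1)]
    calc _ ≤ f (x (k + 1)) + lam (k + 1) / 2 * ‖x (k + 1)‖ ^ 2
            - (f (xlam (lam (k + 1))) + lam (k + 1) / 2 * ‖xlam (lam (k + 1))‖ ^ 2)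
            + (lam (k + 1) - lam (k + 2)) / 2
              * (‖xlam (lam (k + 2))‖ ^ 2 - ‖x (k + 1)‖ ^ 2) := by
          rw [show k + 1 + 1 = k + 2 from rfl]
          linarith
      _ ≤ _ := add_le_add hstep hpert
      _ = _ := by simp only [hκ]; ring
  obtain ⟨M, hM⟩ := eventually_le_rpow_of_recursion (by positivity) (by linarith) (by linarith)
    hδ hErec hcontr hgap
  refine IsBigO.of_bound M ?_
  filter_upwards [hM, eventually_gt_atTop 0] with k hk hk0
  have hE0 : 0 ≤ E k := by
    rw [hE, sub_nonneg]
    exact hxlam _ (hlampos k) (Set.mem_univ (x k))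
  have hkpos : (0 : ℝ) < k := by exact_mod_cast hk0
  have hM0 : 0 ≤ M := nonneg_of_mul_nonneg_left (hE0.trans hk) (by positivity)
  rw [Real.norm_of_nonneg hE0, Real.norm_of_nonneg (by positivity)]
  refine hk.trans (mul_le_mul_of_nonneg_left ?_ hM0)
  rw [neg_sub]
  exact Real.rpow_le_rpow_of_nonpos hkpos (by linarith) (by linarith)
end

section
/- Let X be a separable real Hilbert space and f : X → ℝ a convex, continuously differentiable, L-smooth function with nonempty set of minimizers, and let x⋆ be its minimum-norm minimizer. For λ ≥ 0 let f_λ(x) = f(x) + (λ/2)‖x‖² and let x_λ be a minimizer of f_λ (the unique one for λ > 0). Then for all λ ≥ λ' ≥ 0 it holds that 0 ≤ f_λ(x_λ) − f_{λ'}(x_{λ'}) ≤ ((λ − λ')/2)‖x⋆‖². -/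
open MeasureTheory Filter Asymptotics Real

theorem regularized_value_monotone_bound
    {H : Type*} [NormedAddCommGroup H] [InnerProductSpace ℝ H] [CompleteSpace H]
    [TopologicalSpace.SeparableSpace H]
    (f : H → ℝ) (L : ℝ) (hL : 0 < L)
    (hconv : ConvexOn ℝ Set.univ f)
    (hC1 : ContDiff ℝ 1 f)
    (hLip : LipschitzWith L.toNNReal (gradient f))
    (xstar : H) (hxmin : IsMinOn f Set.univ xstar)
    (hminnorm : ∀ y : H, IsMinOn f Set.univ y → ‖xstar‖ ≤ ‖y‖)
    (xlam : ℝ → H)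
    (hxlam : ∀ l : ℝ, 0 ≤ l → IsMinOn (fun x => f x + l / 2 * ‖x‖ ^ 2) Set.univ (xlam l))
    :
    ∀ l l' : ℝ, 0 ≤ l' → l' ≤ l →
      0 ≤ (f (xlam l) + l / 2 * ‖xlam l‖ ^ 2) - (f (xlam l') + l' / 2 * ‖xlam l'‖ ^ 2) ∧
      (f (xlam l) + l / 2 * ‖xlam l‖ ^ 2) - (f (xlam l') + l' / 2 * ‖xlam l'‖ ^ 2)
        ≤ (l - l') / 2 * ‖xstar‖ ^ 2 := by
  intro l l' hl' hll'
  have hl : 0 ≤ l := hl'.trans hll'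
  have hmin : ∀ m : ℝ, 0 ≤ m → ∀ y : H,
      f (xlam m) + m / 2 * ‖xlam m‖ ^ 2 ≤ f y + m / 2 * ‖y‖ ^ 2 :=
    fun m hm y => hxlam m hm (Set.mem_univ y)
  refine ⟨?_, ?_⟩
  · have h := hmin l' hl' (xlam l)
    have hpos := mul_nonneg (sub_nonneg.2 hll') (sq_nonneg ‖xlam l‖)
    linarith
  · have hstar : f xstar ≤ f (xlam l') := hxmin (Set.mem_univ _)
    rcases hl'.eq_or_lt with rfl | hpos
    · have h := hmin l hl xstar
      linarith
    · have hnorm : ‖xlam l'‖ ^ 2 ≤ ‖xstar‖ ^ 2 := by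
        have h := hmin l' hl' xstar
        refine le_of_mul_le_mul_left ?_ (half_pos hpos)
        linarith
      have h := hmin l hl (xlam l')
      have hdiff := mul_le_mul_of_nonneg_left hnorm (sub_nonneg.2 hll')
      linarith
end

section
/- Let (F_k) be a filtration on a probability space, let (z_k) be a summable sequence of non-negative real numbers, and let (Y_k) be an (F_k)-adapted real-valued sequence that is uniformly bounded from below (there is a constant c with Y_k ≥ c almost surely for all k). Assume that for all k, almost surely E[Y_{k+1} | F_k] ≤ Y_k + z_k. Then (Y_k) converges almost surely. -/
open MeasureTheory Filter Asymptotics Real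

/-- A supermartingale that is uniformly bounded from below converges almost surely. -/
theorem supermartingale_exists_ae_tendsto_of_bddBelow
    {Ω : Type*} {m0 : MeasurableSpace Ω} {μ : Measure Ω} [IsProbabilityMeasure μ]
    {ℱ : Filtration ℕ m0} {X : ℕ → Ω → ℝ} (hX : Supermartingale X ℱ μ)
    {b : ℝ} (hb : ∀ k : ℕ, ∀ᵐ ω ∂μ, b ≤ X k ω) :
    ∀ᵐ ω ∂μ, ∃ l : ℝ, Tendsto (fun k : ℕ => X k ω) atTop (nhds l) := by
  have hL1 : ∀ n, eLpNorm ((-X) n) 1 μ ≤ (Real.toNNReal (∫ ω, X 0 ω ∂μ - b + |b|) : NNReal) := by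
    intro n
    have hmean : ∫ ω, X n ω ∂μ ≤ ∫ ω, X 0 ω ∂μ := by
      simpa using hX.setIntegral_le (Nat.zero_le n) MeasurableSet.univ
    have hnorm : ∫ ω, ‖X n ω‖ ∂μ ≤ ∫ ω, (X n ω + (|b| - b)) ∂μ := by
      refine integral_mono_ae (hX.integrable n).norm
        ((hX.integrable n).add (integrable_const _)) ?_
      filter_upwards [hb n] with ω hω
      rw [Real.norm_eq_abs, abs_le]
      constructor <;> linarith [neg_abs_le b, le_abs_self b]
    rw [integral_add (hX.integrable n) (integrable_const _)] at hnorm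
    simp only [integral_const, probReal_univ, one_smul] at hnorm
    rw [Pi.neg_apply, eLpNorm_neg, eLpNorm_one_eq_lintegral_enorm,
      ← ofReal_integral_norm_eq_lintegral_enorm (hX.integrable n)]
    exact ENNReal.ofReal_le_ofReal (by linarith)
  filter_upwards [hX.neg.exists_ae_tendsto_of_bdd hL1] with ω ⟨l, hl⟩
  exact ⟨-l, by simpa using hl.neg⟩

theorem robbins_siegmund_corollary
    {Ω : Type*} {m0 : MeasurableSpace Ω} {μ : Measure Ω} [IsProbabilityMeasure μ]
    (ℱ : Filtration ℕ m0)
    (Y : ℕ → Ω → ℝ) (hYadapted : Adapted ℱ Y)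
    (hYint : ∀ k : ℕ, Integrable (Y k) μ)
    (z : ℕ → ℝ) (hznonneg : ∀ k : ℕ, 0 ≤ z k) (hzsum : Summable z)
    (c : ℝ) (hbd : ∀ k : ℕ, ∀ᵐ ω ∂μ, c ≤ Y k ω)
    (hineq : ∀ k : ℕ, ∀ᵐ ω ∂μ, (μ[Y (k + 1)|ℱ k]) ω ≤ Y k ω + z k) :
    ∀ᵐ ω ∂μ, ∃ l : ℝ, Tendsto (fun k : ℕ => Y k ω) atTop (nhds l) := by
  set S : ℕ → ℝ := fun k => ∑ i ∈ Finset.range k, z i with hS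
  have hsuper : Supermartingale (fun k ω => Y k ω - S k) ℱ μ := by
    refine supermartingale_nat
      (fun k => (hYadapted k).stronglyMeasurable.sub stronglyMeasurable_const)
      (fun k => (hYint k).sub (integrable_const _)) fun k => ?_
    have hsub := condExp_sub (hYint (k + 1)) (integrable_const (μ := μ) (S (k + 1))) (ℱ k)
    rw [condExp_const (ℱ.le k)] at hsub
    filter_upwards [hsub, hineq k] with ω hω hk
    refine hω.trans_le ?_
    simp only [Pi.sub_apply, hS, Finset.sum_range_succ]
    linarith
  have hbelow : ∀ k, ∀ᵐ ω ∂μ, c - ∑' i, z i ≤ Y k ω - S k := fun k => by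
    filter_upwards [hbd k] with ω hω
    exact sub_le_sub hω (hzsum.sum_le_tsum _ fun i _ => hznonneg i)
  filter_upwards [supermartingale_exists_ae_tendsto_of_bddBelow hsuper hbelow] with ω ⟨l, hl⟩
  exact ⟨l + ∑' i, z i, by simpa [hS] using hl.add hzsum.hasSum.tendsto_sum_nat⟩
end
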